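/- For even n and fixed even prime power q, the limit as n → ∞ (over even n) of i_GL(n,q) / q^{n^2/2} equals (1/2)[ ∏_{i≥1}(1 + √q/q^i) + ∏_{i≥1}(1 − √q/q^i) ], where i_GL(n,q) is the number of involutions (elements of order dividing 2) in GL(n, F_q). Moreover this value equals ∏_{i≥1} (1 + q^{5-8i})(1 + q^{3-8i})(1 - q^{-8i})/(1 - q^{-2i}). -/

import Mathlib

open Filter Topology Finset Module

/-- The finite `q`-Pochhammer symbol `∏_{1 ≤ i ≤ n} (1 - Qⁱ)`. -/
noncomputable def qPoch (Q : ℝ) (n : ℕ) : ℝ := ∏ i ∈ range n, (1 - Q ^ (i + 1))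

/-- The Gaussian binomial coefficient at `Q`, defined by its Pascal recurrence. -/
noncomputable def gaussBinom (Q : ℝ) : ℕ → ℕ → ℝ
  | _, 0 => 1
  | 0, _ + 1 => 0
  | n + 1, k + 1 => gaussBinom Q n (k + 1) + Q ^ (n - k) * gaussBinom Q n k

theorem qPoch_zero (Q : ℝ) : qPoch Q 0 = 1 := by simp [qPoch]

theorem qPoch_succ (Q : ℝ) (n : ℕ) : qPoch Q (n + 1) = qPoch Q n * (1 - Q ^ (n + 1)) := by
  simp [qPoch, prod_range_succ]

theorem gaussBinom_zero_right (Q : ℝ) (n : ℕ) : gaussBinom Q n 0 = 1 := by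
  cases n <;> simp [gaussBinom]

theorem gaussBinom_eq_zero_of_lt (Q : ℝ) (n k : ℕ) (h : n < k) : gaussBinom Q n k = 0 := by
  induction n generalizing k with
  | zero =>
    obtain ⟨k, rfl⟩ : ∃ j, k = j + 1 := ⟨k - 1, by omega⟩
    simp [gaussBinom]
  | succ n ih =>
    obtain ⟨k, rfl⟩ : ∃ j, k = j + 1 := ⟨k - 1, by omega⟩
    simp [gaussBinom, ih (k + 1) (by omega), ih k (by omega)]

theorem gaussBinom_self (Q : ℝ) (n : ℕ) : gaussBinom Q n n = 1 := by
  induction n with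
  | zero => simp [gaussBinom]
  | succ n ih => simp [gaussBinom, ih, gaussBinom_eq_zero_of_lt]

theorem gaussBinom_mul_qPoch (Q : ℝ) (k l : ℕ) :
    gaussBinom Q (k + l) k * (qPoch Q k * qPoch Q l) = qPoch Q (k + l) := by
  induction hn : k + l generalizing k l with
  | zero =>
    obtain ⟨rfl, rfl⟩ : k = 0 ∧ l = 0 := by omega
    simp [gaussBinom, qPoch]
  | succ n ih =>
    rcases k with _ | k
    · obtain rfl : l = n + 1 := by omega
      simp [gaussBinom_zero_right, qPoch_zero]
    rcases l with _ | l
    · obtain rfl : k = n := by omega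
      simp [gaussBinom_self, qPoch_zero]
    have h1 := ih (k + 1) l (by omega)
    have h2 := ih k (l + 1) (by omega)
    rw [qPoch_succ] at h1 h2
    have hk : n - k = l + 1 := by omega
    have hp : Q ^ (n + 1) = Q ^ (l + 1) * Q ^ (k + 1) := by rw [← pow_add]; congr 1; omega
    simp only [gaussBinom, qPoch_succ, hk, hp]
    linear_combination (1 - Q ^ (l + 1)) * h1 + Q ^ (l + 1) * (1 - Q ^ (k + 1)) * h2

/-- The finite `q`-binomial theorem, with base `x²`. -/
theorem prod_one_add_mul_pow_odd (x z : ℝ) (n : ℕ) :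
    ∏ i ∈ range n, (1 + z * x ^ (2 * i + 1)) =
      ∑ k ∈ range (n + 1), gaussBinom (x ^ 2) n k * (x ^ k ^ 2 * z ^ k) := by
  induction n with
  | zero => simp [gaussBinom]
  | succ n ih =>
    rw [prod_range_succ, ih, sum_range_succ' _ (n + 1)]
    have h : ∀ k ∈ range (n + 1), gaussBinom (x ^ 2) (n + 1) (k + 1) *
        (x ^ (k + 1) ^ 2 * z ^ (k + 1)) =
        gaussBinom (x ^ 2) n (k + 1) * (x ^ (k + 1) ^ 2 * z ^ (k + 1)) +
        z * x ^ (2 * n + 1) * (gaussBinom (x ^ 2) n k * (x ^ k ^ 2 * z ^ k)) := by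
      intro k hk
      have hk : k ≤ n := by simpa [Nat.lt_succ_iff] using hk
      have hp : (x ^ 2) ^ (n - k) * x ^ (k + 1) ^ 2 = x ^ (2 * n + 1) * x ^ k ^ 2 := by
        rw [← pow_mul, ← pow_add, ← pow_add]
        congr 1
        obtain ⟨m, rfl⟩ := Nat.exists_eq_add_of_le hk
        rw [Nat.add_sub_cancel_left]
        ring
      simp only [gaussBinom]
      linear_combination gaussBinom (x ^ 2) n k * z ^ (k + 1) * hp
    rw [sum_congr rfl h, sum_add_distrib, ← mul_sum,
      sum_range_succ (fun k => gaussBinom (x ^ 2) n (k + 1) * _) n, gaussBinom_eq_zero_of_lt _ n _ n.lt_succ_self,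
      sum_range_succ' _ n]
    simp only [gaussBinom_zero_right]
    ring

section Limits

variable {Q : ℝ}

theorem qPoch_pos (h0 : 0 ≤ Q) (h1 : Q < 1) (n : ℕ) : 0 < qPoch Q n :=
  prod_pos fun i _ => sub_pos.2 (pow_lt_one₀ h0 h1 i.succ_ne_zero)

theorem qPoch_le_one (h0 : 0 ≤ Q) (h1 : Q < 1) (n : ℕ) : qPoch Q n ≤ 1 :=
  prod_le_one (fun _ _ => sub_nonneg.2 (pow_le_one₀ h0 h1.le))
    fun _ _ => sub_le_self _ (pow_nonneg h0 _)

theorem summable_pow_succ (h0 : 0 ≤ Q) (h1 : Q < 1) : Summable fun i : ℕ => Q ^ (i + 1) :=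
  (summable_nat_add_iff 1).2 (summable_geometric_of_lt_one h0 h1)

theorem multipliable_one_sub_pow_succ (h0 : 0 ≤ Q) (h1 : Q < 1) :
    Multipliable fun i : ℕ => 1 - Q ^ (i + 1) := by
  simpa [sub_eq_add_neg] using
    Real.multipliable_one_add_of_summable (summable_pow_succ h0 h1).neg

theorem tendsto_qPoch (h0 : 0 ≤ Q) (h1 : Q < 1) :
    Tendsto (qPoch Q) atTop (𝓝 (∏' i : ℕ, (1 - Q ^ (i + 1)))) :=
  (multipliable_one_sub_pow_succ h0 h1).hasProd.tendsto_prod_nat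

theorem tprod_one_sub_pow_succ_pos (h0 : 0 ≤ Q) (h1 : Q < 1) :
    0 < ∏' i : ℕ, (1 - Q ^ (i + 1)) := by
  refine lt_of_le_of_ne (ge_of_tendsto' (tendsto_qPoch h0 h1) fun n => (qPoch_pos h0 h1 n).le) ?_
  have := tprod_one_add_ne_zero_of_summable (f := fun i : ℕ => -Q ^ (i + 1)) ?_ ?_
  · simpa [sub_eq_add_neg] using this.symm
  · intro i
    have := pow_lt_one₀ h0 h1 i.succ_ne_zero
    rw [← sub_eq_add_neg]
    exact (sub_pos.2 this).ne'
  · simpa using (summable_pow_succ h0 h1).norm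

theorem tprod_le_qPoch (h0 : 0 ≤ Q) (h1 : Q < 1) (n : ℕ) :
    ∏' i : ℕ, (1 - Q ^ (i + 1)) ≤ qPoch Q n := by
  refine Antitone.le_of_tendsto (antitone_nat_of_succ_le fun n => ?_) (tendsto_qPoch h0 h1) n
  rw [qPoch_succ]
  exact mul_le_of_le_one_right (qPoch_pos h0 h1 n).le (sub_le_self _ (pow_nonneg h0 _))

theorem gaussBinom_eq (h0 : 0 ≤ Q) (h1 : Q < 1) (k l : ℕ) :
    gaussBinom Q (k + l) k = qPoch Q (k + l) / (qPoch Q k * qPoch Q l) := by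
  rw [eq_div_iff (mul_pos (qPoch_pos h0 h1 k) (qPoch_pos h0 h1 l)).ne', gaussBinom_mul_qPoch]

theorem abs_gaussBinom_le (h0 : 0 ≤ Q) (h1 : Q < 1) (n k : ℕ) :
    |gaussBinom Q n k| ≤ 1 / (∏' i : ℕ, (1 - Q ^ (i + 1))) ^ 2 := by
  have hE := tprod_one_sub_pow_succ_pos h0 h1
  rcases lt_or_ge n k with h | h
  · rw [gaussBinom_eq_zero_of_lt _ _ _ h, abs_zero]
    positivity
  obtain ⟨l, rfl⟩ := Nat.exists_eq_add_of_le h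
  have hk := qPoch_pos h0 h1 k
  have hl := qPoch_pos h0 h1 l
  have hkl := qPoch_pos h0 h1 (k + l)
  rw [gaussBinom_eq h0 h1, abs_of_nonneg (by positivity), sq]
  exact div_le_div₀ zero_le_one (qPoch_le_one h0 h1 _) (by positivity)
    (mul_le_mul (tprod_le_qPoch h0 h1 k) (tprod_le_qPoch h0 h1 l) hE.le hk.le)

theorem tendsto_gaussBinom (h0 : 0 ≤ Q) (h1 : Q < 1) {u v : ℕ → ℕ} {a b : ℝ}
    (hb : b ≠ 0) (ha : a ≠ 0)
    (huv : ∀ᶠ n in atTop, v n ≤ u n) (hu : Tendsto u atTop atTop)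
    (hv : Tendsto (fun n => qPoch Q (v n)) atTop (𝓝 a))
    (hw : Tendsto (fun n => qPoch Q (u n - v n)) atTop (𝓝 b)) :
    Tendsto (fun n => gaussBinom Q (u n) (v n)) atTop
      (𝓝 ((∏' i : ℕ, (1 - Q ^ (i + 1))) / (a * b))) := by
  refine Tendsto.congr' ?_ ((((tendsto_qPoch h0 h1).comp hu).div (hv.mul hw)) (mul_ne_zero ha hb))
  filter_upwards [huv] with n hn
  obtain ⟨l, hl⟩ := Nat.exists_eq_add_of_le hn
  simp [hl, gaussBinom_eq h0 h1]

end Limits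

theorem summable_pow_sq {x : ℝ} (h0 : 0 ≤ x) (h1 : x < 1) : Summable fun k : ℕ => x ^ k ^ 2 :=
  (summable_geometric_of_lt_one h0 h1).of_nonneg_of_le (fun k => by positivity)
    fun k => pow_le_pow_of_le_one h0 h1.le (Nat.le_self_pow two_ne_zero k)

theorem multipliable_one_add_mul_pow_odd {x : ℝ} (h0 : 0 ≤ x) (h1 : x < 1) (z : ℝ) :
    Multipliable fun i : ℕ => 1 + z * x ^ (2 * i + 1) := by
  refine Real.multipliable_one_add_of_summable (Summable.mul_left z ?_)
  exact (summable_geometric_of_lt_one h0 h1).comp_injective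
    (i := fun i => 2 * i + 1) fun a b h => by simpa using h

/-- Euler's expansion of `∏ (1 + z x^(2i+1))`. -/
theorem tprod_one_add_mul_pow_odd {x z : ℝ} (h0 : 0 ≤ x) (h1 : x < 1) (hz : |z| ≤ 1) :
    ∏' i : ℕ, (1 + z * x ^ (2 * i + 1)) = ∑' k : ℕ, x ^ k ^ 2 * z ^ k / qPoch (x ^ 2) k := by
  have hQ0 : 0 ≤ x ^ 2 := by positivity
  have hQ1 : x ^ 2 < 1 := pow_lt_one₀ h0 h1 two_ne_zero
  set E := ∏' i : ℕ, (1 - (x ^ 2) ^ (i + 1)) with hE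
  have hEpos : 0 < E := tprod_one_sub_pow_succ_pos hQ0 hQ1
  refine tendsto_nhds_unique
    (multipliable_one_add_mul_pow_odd h0 h1 z).hasProd.tendsto_prod_nat ?_
  have key : Tendsto (fun n : ℕ => ∑' k : ℕ, gaussBinom (x ^ 2) n k * (x ^ k ^ 2 * z ^ k)) atTop
      (𝓝 (∑' k : ℕ, x ^ k ^ 2 * z ^ k / qPoch (x ^ 2) k)) := by
    refine tendsto_tsum_of_dominated_convergence ((summable_pow_sq h0 h1).mul_left (1 / E ^ 2))
      (fun k => ?_) (Eventually.of_forall fun n k => ?_)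
    · have hk := (qPoch_pos hQ0 hQ1 k).ne'
      have := tendsto_gaussBinom hQ0 hQ1 (u := id) (v := fun _ => k) hEpos.ne' hk
        (eventually_ge_atTop k) tendsto_id tendsto_const_nhds
        ((tendsto_qPoch hQ0 hQ1).comp (tendsto_sub_atTop_nat k))
      rw [← hE] at this
      rw [show x ^ k ^ 2 * z ^ k / qPoch (x ^ 2) k =
        E / (qPoch (x ^ 2) k * E) * (x ^ k ^ 2 * z ^ k) by field_simp]
      exact this.mul_const _
    · rw [Real.norm_eq_abs, abs_mul]
      refine mul_le_mul (abs_gaussBinom_le hQ0 hQ1 n k) ?_ (abs_nonneg _) (by positivity)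
      rw [abs_mul, abs_of_nonneg (by positivity : 0 ≤ x ^ k ^ 2), abs_pow]
      exact mul_le_of_le_one_right (by positivity) (pow_le_one₀ (abs_nonneg _) hz)
  refine key.congr fun n => ?_
  rw [prod_one_add_mul_pow_odd, tsum_eq_sum]
  intro k hk
  rw [gaussBinom_eq_zero_of_lt _ _ _ (by simpa using hk), zero_mul]

/-- The finite form of the Jacobi triple product. -/
theorem prod_mul_prod_one_add_mul_pow_odd {y z : ℝ} (hy : y ≠ 0) (hz : z ≠ 0) (n : ℕ) :
    (∏ i ∈ range n, (1 + z * y ^ (2 * i + 1))) * ∏ i ∈ range n, (1 + z⁻¹ * y ^ (2 * i + 1)) =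
      ∑ k ∈ range (2 * n + 1),
        gaussBinom (y ^ 2) (2 * n) k * (y ^ ((k - n : ℤ) ^ 2) * z ^ (k - n : ℤ)) := by
  have h := prod_one_add_mul_pow_odd y (z * y ^ (-(2 * n : ℤ))) (2 * n)
  have hodd : ∏ i ∈ range n, (z * y ^ (-(2 * i + 1 : ℤ))) = z ^ n * y ^ (-(n ^ 2 : ℤ)) := by
    induction n with
    | zero => simp
    | succ n ih =>
      rw [prod_range_succ, ih (prod_one_add_mul_pow_odd ..)]
      have : y ^ (-((n + 1 : ℕ) ^ 2 : ℤ)) = y ^ (-(n ^ 2 : ℤ)) * y ^ (-(2 * n + 1 : ℤ)) := by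
        rw [← zpow_add₀ hy]; congr 1; push_cast; ring
      rw [this]; ring
  have hl : ∏ i ∈ range (2 * n), (1 + z * y ^ (-(2 * n : ℤ)) * y ^ (2 * i + 1)) =
      z ^ n * y ^ (-(n ^ 2 : ℤ)) *
      ((∏ i ∈ range n, (1 + z * y ^ (2 * i + 1))) *
        ∏ i ∈ range n, (1 + z⁻¹ * y ^ (2 * i + 1))) := by
    rw [two_mul n, prod_range_add, mul_comm (∏ i ∈ range n, (1 + z * y ^ (2 * i + 1) : ℝ)),
      ← mul_assoc, ← hodd]
    refine congrArg₂ (· * ·) ?_ ?_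
    · rw [← prod_mul_distrib,
        ← prod_range_reflect fun i : ℕ => 1 + z * y ^ (-(2 * n : ℤ)) * y ^ (2 * i + 1)]
      refine prod_congr rfl fun i hi => ?_
      have hi : i < n := by simpa using hi
      have e : y ^ (-(2 * n : ℤ)) * y ^ (2 * (n - 1 - i) + 1) = y ^ (-(2 * i + 1 : ℤ)) := by
        rw [← zpow_natCast, ← zpow_add₀ hy]; congr 1; push_cast
        rw [Nat.cast_sub (by omega), Nat.cast_sub (by omega)]; push_cast; ring
      have e' : y ^ (-(2 * i + 1 : ℤ)) * y ^ (2 * i + 1) = 1 := by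
        rw [← zpow_natCast, ← zpow_add₀ hy]; simp
      rw [mul_assoc, e]
      linear_combination (-(z * z⁻¹)) * e' - mul_inv_cancel₀ hz
    · refine prod_congr rfl fun i _ => ?_
      rw [mul_assoc]
      congr 2
      rw [← zpow_natCast, ← zpow_natCast, ← zpow_add₀ hy]; congr 1; push_cast; ring
  have hc : z ^ n * y ^ (-(n ^ 2 : ℤ)) ≠ 0 := mul_ne_zero (pow_ne_zero _ hz) (zpow_ne_zero _ hy)
  apply mul_left_cancel₀ hc
  rw [← hl, h, mul_sum]
  refine sum_congr rfl fun k _ => ?_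
  have e1 : y ^ k ^ 2 * (y ^ (-(2 * n : ℤ))) ^ k = y ^ (-(n ^ 2 : ℤ)) * y ^ ((k - n : ℤ) ^ 2) := by
    rw [← zpow_natCast, ← zpow_natCast, ← zpow_mul, ← zpow_add₀ hy, ← zpow_add₀ hy]
    congr 1; push_cast; ring
  have e2 : z ^ k = z ^ n * z ^ (k - n : ℤ) := by
    rw [← zpow_natCast, ← zpow_natCast, ← zpow_add₀ hz]; congr 1; ring
  rw [mul_pow, e2]
  linear_combination (gaussBinom (y ^ 2) (2 * n) k * (z ^ n * z ^ (k - n : ℤ))) * e1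

/-- The Jacobi triple product identity. -/
theorem jacobi_triple_product {y z : ℝ} (h0 : 0 < y) (h1 : y < 1) (hz : z ≠ 0)
    (hs : Summable fun k : ℤ => y ^ (k ^ 2) * |z| ^ k) :
    (∏' i : ℕ, (1 - (y ^ 2) ^ (i + 1))) *
      ((∏' i : ℕ, (1 + z * y ^ (2 * i + 1))) * ∏' i : ℕ, (1 + z⁻¹ * y ^ (2 * i + 1))) =
      ∑' k : ℤ, y ^ (k ^ 2) * z ^ k := by
  have hQ0 : 0 ≤ y ^ 2 := by positivity
  have hQ1 : y ^ 2 < 1 := pow_lt_one₀ h0.le h1 two_ne_zero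
  set E := ∏' i : ℕ, (1 - (y ^ 2) ^ (i + 1)) with hE
  have hEpos : 0 < E := tprod_one_sub_pow_succ_pos hQ0 hQ1
  have hL := (multipliable_one_add_mul_pow_odd h0.le h1 z).hasProd.tendsto_prod_nat.mul
    (multipliable_one_add_mul_pow_odd h0.le h1 z⁻¹).hasProd.tendsto_prod_nat
  have hR : Tendsto (fun n : ℕ => ∑' k : ℤ, (if -(n : ℤ) ≤ k then
      gaussBinom (y ^ 2) (2 * n) (k + n).toNat else 0) * (y ^ (k ^ 2) * z ^ k)) atTop
      (𝓝 (∑' k : ℤ, E⁻¹ * (y ^ (k ^ 2) * z ^ k))) := by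
    refine tendsto_tsum_of_dominated_convergence (hs.mul_left (1 / E ^ 2))
      (fun k => ?_) (Eventually.of_forall fun n k => ?_)
    · have hlim : ∀ w : ℕ → ℕ, Tendsto w atTop atTop →
          Tendsto (fun n => qPoch (y ^ 2) (w n)) atTop (𝓝 E) :=
        fun w hw => (tendsto_qPoch hQ0 hQ1).comp hw
      have := tendsto_gaussBinom hQ0 hQ1 (u := fun n => 2 * n) (v := fun n => (k + n).toNat)
        hEpos.ne' hEpos.ne'
        (by filter_upwards [eventually_ge_atTop k.natAbs] with n hn; omega)
        (tendsto_atTop_mono (fun n => Nat.le_mul_of_pos_left n two_pos) tendsto_id)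
        (hlim _ (tendsto_atTop_mono (fun n => by omega) (tendsto_sub_atTop_nat k.natAbs)))
        (hlim _ (tendsto_atTop_mono (fun n => by omega) (tendsto_sub_atTop_nat k.natAbs)))
      rw [← hE] at this
      rw [show E⁻¹ = E / (E * E) by field_simp]
      refine (this.congr' ?_).mul_const _
      filter_upwards [eventually_ge_atTop k.natAbs] with n hn
      rw [if_pos (by omega)]
    · rw [Real.norm_eq_abs, abs_mul]
      refine mul_le_mul ?_ ?_ (abs_nonneg _) (by positivity)
      · split_ifs
        · exact abs_gaussBinom_le hQ0 hQ1 _ _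
        · rw [abs_zero]; positivity
      · rw [abs_mul, abs_zpow, abs_zpow, abs_of_pos h0]
  have hfin := tendsto_nhds_unique (hL.congr fun n => ?_) hR
  · rw [hfin, tsum_mul_left, mul_inv_cancel_left₀ hEpos.ne']
  · rw [prod_mul_prod_one_add_mul_pow_odd h0.ne' hz]
    symm
    have hinj : Function.Injective fun k : ℕ => (k : ℤ) - n := fun a b h => by simpa using h
    have := hinj.tsum_eq (f := fun k : ℤ => (if -(n : ℤ) ≤ k then
      gaussBinom (y ^ 2) (2 * n) (k + n).toNat else 0) * (y ^ (k ^ 2) * z ^ k)) ?_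
    · rw [← this, tsum_eq_sum (s := range (2 * n + 1))]
      · refine sum_congr rfl fun k _ => ?_
        simp
      · intro k hk
        rw [gaussBinom_eq_zero_of_lt _ _ _ (by simp at hk ⊢; omega)]
        simp
    · intro k hk
      by_cases h : -(n : ℤ) ≤ k
      · exact ⟨(k + n).toNat, by simp; omega⟩
      · simp [h] at hk

theorem tprod_half_sum_eq_tsum {x : ℝ} (h0 : 0 ≤ x) (h1 : x < 1) :
    1 / 2 * ((∏' i : ℕ, (1 + 1 * x ^ (2 * i + 1))) + ∏' i : ℕ, (1 + -1 * x ^ (2 * i + 1))) =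
      ∑' s : ℕ, x ^ (4 * s ^ 2) / qPoch (x ^ 2) (2 * s) := by
  have hQ0 : 0 ≤ x ^ 2 := by positivity
  have hQ1 : x ^ 2 < 1 := pow_lt_one₀ h0 h1 two_ne_zero
  have hE := tprod_one_sub_pow_succ_pos hQ0 hQ1
  have hsum : ∀ z : ℝ, |z| ≤ 1 →
      Summable fun k : ℕ => x ^ k ^ 2 * z ^ k / qPoch (x ^ 2) k := by
    intro z hz
    refine ((summable_pow_sq h0 h1).div_const (∏' i : ℕ, (1 - (x ^ 2) ^ (i + 1)))).of_norm_bounded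
      fun k => ?_
    rw [Real.norm_eq_abs, abs_div, abs_mul, abs_of_pos (qPoch_pos hQ0 hQ1 k),
      abs_of_nonneg (by positivity : 0 ≤ x ^ k ^ 2), abs_pow]
    exact div_le_div₀ (by positivity) (mul_le_of_le_one_right (by positivity)
      (pow_le_one₀ (abs_nonneg _) hz)) hE (tprod_le_qPoch hQ0 hQ1 k)
  rw [tprod_one_add_mul_pow_odd h0 h1 (by simp), tprod_one_add_mul_pow_odd h0 h1 (by simp),
    ← (hsum 1 (by simp)).tsum_add (hsum (-1) (by simp)), ← tsum_mul_left]
  have hinj : Function.Injective fun s : ℕ => 2 * s := fun a b h => by simpa using h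
  rw [← hinj.tsum_eq]
  · refine tsum_congr fun s => ?_
    rw [pow_mul (-1 : ℝ)]
    norm_num
    ring
  · intro k hk
    rcases Nat.even_or_odd' k with ⟨s, rfl | rfl⟩
    · exact ⟨s, rfl⟩
    · have hodd : (-1 : ℝ) ^ (2 * s + 1) = -1 := by rw [pow_succ, pow_mul]; norm_num
      refine absurd ?_ hk
      simp only [hodd, one_pow]
      ring

theorem summable_zpow_of_natAbs_le {x : ℝ} (h0 : 0 < x) (h1 : x < 1) {e : ℤ → ℤ}
    (he : ∀ k, |k| ≤ e k) : Summable fun k : ℤ => x ^ e k := by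
  have hs : Summable fun k : ℤ => x ^ |k| := by
    refine Summable.of_nat_of_neg ?_ ?_ <;> simpa using summable_geometric_of_lt_one h0.le h1
  exact hs.of_nonneg_of_le (fun k => by positivity)
    fun k => zpow_le_zpow_right_of_le_one₀ h0 h1.le (he k)

/-- A dissection of `∏ (1 ± x^(2i+1))` as a theta series. -/
theorem tprod_mul_tprod_odd_eq_tsum {x z : ℝ} (h0 : 0 < x) (h1 : x < 1) (hz : z = 1 ∨ z = -1) :
    (∏' i : ℕ, (1 - (x ^ 4) ^ (i + 1))) * ∏' i : ℕ, (1 + z * x ^ (2 * i + 1)) =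
      ∑' k : ℤ, x ^ (2 * k ^ 2 + k) * z ^ k := by
  have hz0 : z ≠ 0 := by rcases hz with rfl | rfl <;> norm_num
  have hzi : z⁻¹ = z := by rcases hz with rfl | rfl <;> norm_num
  have hza : |z| = 1 := by rcases hz with rfl | rfl <;> norm_num
  have hx2 : x ^ 2 < 1 := pow_lt_one₀ h0.le h1 two_ne_zero
  have he : ∀ k : ℤ, (x ^ 2) ^ (k ^ 2) * x ^ k = x ^ (2 * k ^ 2 + k) := fun k => by
    rw [zpow_add₀ h0.ne', zpow_mul]; norm_cast
  have hJ := jacobi_triple_product (y := x ^ 2) (z := z * x) (by positivity) hx2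
    (mul_ne_zero hz0 h0.ne') (by
      simp only [abs_mul, hza, one_mul, abs_of_pos h0, he]
      refine summable_zpow_of_natAbs_le h0 h1 fun k => ?_
      rw [abs_le]
      constructor <;> rcases le_or_gt k 0 with h | h <;> nlinarith)
  have hm := multipliable_one_add_mul_pow_odd h0.le h1 z
  have hm' : ∀ f : ℕ → ℕ, Function.Injective f →
      Multipliable fun i : ℕ => 1 + z * x ^ (2 * f i + 1) := fun f hf => by
    refine Real.multipliable_one_add_of_summable (Summable.mul_left z ?_)
    exact (summable_geometric_of_lt_one h0.le h1).comp_injective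
      (i := fun i => 2 * f i + 1) fun a b h => hf (by simpa using h)
  have hsplit := tprod_even_mul_odd (f := fun i => 1 + z * x ^ (2 * i + 1))
    (hm' (fun k => 2 * k) fun a b h => by simpa using h)
    (hm' (fun k => 2 * k + 1) fun a b h => by simpa using h)
  rw [← hsplit]
  convert hJ using 2
  · exact tprod_congr fun i => by ring
  · rw [mul_comm]
    congr 1
    · exact tprod_congr fun i => by ring
    · refine tprod_congr fun i => ?_
      rw [mul_inv, hzi]
      field_simp
      ring
  · ext k
    rw [← he, mul_zpow]
    ring

theorem tprod_half_sum_eq_tprod {x : ℝ} (h0 : 0 < x) (h1 : x < 1) :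
    1 / 2 * ((∏' i : ℕ, (1 + 1 * x ^ (2 * i + 1))) + ∏' i : ℕ, (1 + -1 * x ^ (2 * i + 1))) =
      ∏' i : ℕ, ((1 + x ^ (16 * i + 6)) * (1 + x ^ (16 * i + 10)) * (1 - x ^ (16 * (i + 1))) /
        (1 - x ^ (4 * (i + 1)))) := by
  have hx : ∀ n : ℕ, n ≠ 0 → x ^ n < 1 := fun n hn => pow_lt_one₀ h0.le h1 hn
  have hE := tprod_one_sub_pow_succ_pos (Q := x ^ 4) (by positivity) (hx 4 (by norm_num))
  have hsum : ∀ z : ℝ, z = 1 ∨ z = -1 → Summable fun k : ℤ => x ^ (2 * k ^ 2 + k) * z ^ k := by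
    intro z hz
    have hza : |z| = 1 := by rcases hz with rfl | rfl <;> norm_num
    refine (summable_zpow_of_natAbs_le h0 h1 (e := fun k => 2 * k ^ 2 + k) fun k => ?_).of_norm_bounded
      fun k => ?_
    · rw [abs_le]
      constructor <;> rcases le_or_gt k 0 with h | h <;> nlinarith
    · rw [Real.norm_eq_abs, abs_mul, abs_zpow, abs_zpow, hza, one_zpow, mul_one, abs_of_pos h0]
  have he : ∀ k : ℤ, (x ^ 8) ^ (k ^ 2) * (x ^ 2) ^ k = x ^ (2 * (2 * k) ^ 2 + 2 * k) := fun k => by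
    rw [show 2 * (2 * k) ^ 2 + 2 * k = 8 * k ^ 2 + 2 * k by ring, zpow_add₀ h0.ne', zpow_mul,
      zpow_mul]
    norm_cast
  have hJ := jacobi_triple_product (y := x ^ 8) (z := x ^ 2) (by positivity) (hx 8 (by norm_num))
    (by positivity) (by
      simp only [abs_pow, abs_of_pos h0, he]
      refine summable_zpow_of_natAbs_le h0 h1 fun k => ?_
      rw [abs_le]
      constructor <;> rcases le_or_gt k 0 with h | h <;> nlinarith)
  have hmul : ∀ z : ℝ, Multipliable fun i : ℕ => 1 + z * (x ^ 8) ^ (2 * i + 1) :=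
    multipliable_one_add_mul_pow_odd (by positivity) (hx 8 (by norm_num))
  have hnum := ((hmul (x ^ 2)⁻¹).hasProd.mul (hmul (x ^ 2)).hasProd).mul
    (multipliable_one_sub_pow_succ (Q := (x ^ 8) ^ 2) (by positivity)
      (by rw [← pow_mul]; exact hx _ (by norm_num))).hasProd
  have hquot := hnum.div₀ (multipliable_one_sub_pow_succ (Q := x ^ 4) (by positivity)
    (hx 4 (by norm_num))).hasProd hE.ne'
  have htheta : ∑' k : ℤ, (x ^ 8) ^ (k ^ 2) * (x ^ 2) ^ k =
      1 / 2 * ∑' k : ℤ, (x ^ (2 * k ^ 2 + k) * 1 ^ k + x ^ (2 * k ^ 2 + k) * (-1) ^ k) := by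
    have hinj : Function.Injective fun s : ℤ => 2 * s := fun a b h => by simpa using h
    symm
    rw [← hinj.tsum_eq, ← tsum_mul_left]
    · refine tsum_congr fun k => ?_
      rw [he, zpow_mul (-1 : ℝ)]
      norm_num
      ring
    · intro k hk
      rcases Int.even_or_odd' k with ⟨s, rfl | rfl⟩
      · exact ⟨s, rfl⟩
      · have hodd : (-1 : ℝ) ^ (2 * s + 1) = -1 := by
          rw [zpow_add₀ (by norm_num), zpow_mul]; norm_num
        refine absurd ?_ hk
        simp only [hodd, one_zpow]
        ring
  apply mul_left_cancel₀ hE.ne'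
  rw [mul_left_comm, mul_add, tprod_mul_tprod_odd_eq_tsum h0 h1 (Or.inl rfl),
    tprod_mul_tprod_odd_eq_tsum h0 h1 (Or.inr rfl),
    ← (hsum 1 (Or.inl rfl)).tsum_add (hsum (-1) (Or.inr rfl)), ← htheta, ← hJ]
  rw [show (fun i : ℕ => (1 + x ^ (16 * i + 6)) * (1 + x ^ (16 * i + 10)) *
      (1 - x ^ (16 * (i + 1))) / (1 - x ^ (4 * (i + 1)))) = _ from ?_, hquot.tprod_eq]
  · field_simp
  · ext i
    congr 1
    · congr 1
      · congr 1
        · field_simp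
          ring
        · ring
      · ring
    · ring

section SquareZero

variable {F : Type*} [Field F]

/-- Square-zero endomorphisms of rank `r`. -/
abbrev SqZero (F V : Type*) [Field F] [AddCommGroup V] [Module F V] (r : ℕ) : Type _ :=
  {N : Module.End F V // N * N = 0 ∧ finrank F (LinearMap.ker N) + r = finrank F V}

variable {V W : Type*} [AddCommGroup V] [Module F V] [AddCommGroup W] [Module F W]

/-- The square-zero endomorphism of `(F × F) × W` sending the first basis vector to the second,
built from a square-zero endomorphism of `W` and a linear form on `W`. -/
def sqZeroExtend (M : Module.End F W) (b : W →ₗ[F] F) : Module.End F ((F × F) × W) :=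
  LinearMap.prod
    (LinearMap.prod (-(b ∘ₗ M ∘ₗ LinearMap.snd F (F × F) W))
      (LinearMap.fst F F F ∘ₗ LinearMap.fst F (F × F) W + b ∘ₗ LinearMap.snd F (F × F) W))
    (M ∘ₗ LinearMap.snd F (F × F) W)

@[simp] theorem sqZeroExtend_apply (M : Module.End F W) (b : W →ₗ[F] F) (v : (F × F) × W) :
    sqZeroExtend M b v = ((-b (M v.2), v.1.1 + b v.2), M v.2) := rfl

theorem sqZeroExtend_mul_self {M : Module.End F W} (hM : M * M = 0) (b : W →ₗ[F] F) :
    sqZeroExtend M b * sqZeroExtend M b = 0 := by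
  have hM' : ∀ w, M (M w) = 0 := LinearMap.congr_fun hM
  ext x <;> simp [hM']

/-- The kernel of `sqZeroExtend M b` is `F × ker M`. -/
def kerSqZeroExtend (M : Module.End F W) (b : W →ₗ[F] F) :
    LinearMap.ker (sqZeroExtend M b) ≃ₗ[F] F × LinearMap.ker M where
  toFun v := (v.1.1.2, ⟨v.1.2, by
    exact congrArg Prod.snd (LinearMap.mem_ker.1 v.2)⟩)
  invFun u := ⟨((-b u.2.1, u.1), u.2.1), by simp⟩
  map_add' _ _ := rfl
  map_smul' _ _ := rfl
  left_inv v := by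
    obtain ⟨⟨⟨s, t⟩, w⟩, hv⟩ := v
    simp at hv
    simp
    linear_combination -hv.1.2
  right_inv _ := rfl

theorem eq_sqZeroExtend {N : Module.End F ((F × F) × W)} (hN : N * N = 0)
    (h1 : N ((1, 0), 0) = ((0, 1), 0)) :
    N = sqZeroExtend (LinearMap.snd F (F × F) W ∘ₗ N ∘ₗ LinearMap.inr F (F × F) W)
      (LinearMap.snd F F F ∘ₗ LinearMap.fst F (F × F) W ∘ₗ N ∘ₗ LinearMap.inr F (F × F) W) ∧
    (LinearMap.snd F (F × F) W ∘ₗ N ∘ₗ LinearMap.inr F (F × F) W) *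
      (LinearMap.snd F (F × F) W ∘ₗ N ∘ₗ LinearMap.inr F (F × F) W) = 0 := by
  have h2 : N ((0, 1), 0) = 0 := by rw [← h1]; exact LinearMap.congr_fun hN _
  have hdec : ∀ (s t : F) (w : W), N ((s, t), w) = ((0, s), 0) + N (0, w) := by
    intro s t w
    have : (((s, t), w) : (F × F) × W) = s • ((1, 0), 0) + t • ((0, 1), 0) + (0, w) := by
      simp
    rw [this, map_add, map_add, map_smul, map_smul, h1, h2]
    simp
  have hsq : ∀ w : W, (N (0, w)).1.1 = -(N (0, (N (0, w)).2)).1.2 ∧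
      (N (0, (N (0, w)).2)).2 = 0 := by
    intro w
    have h := LinearMap.congr_fun hN (0, w)
    have h' : (0 : (F × F) × W) = _ := h.symm.trans (hdec (N (0, w)).1.1 (N (0, w)).1.2 (N (0, w)).2)
    have ha := congrArg (fun v => v.1.2) h'
    have hb := congrArg (fun v => v.2) h'
    simp at ha hb
    exact ⟨by linear_combination -ha, hb.symm⟩
  refine ⟨LinearMap.ext fun ⟨⟨s, t⟩, w⟩ => ?_, LinearMap.ext fun w => (hsq w).2⟩
  rw [hdec]
  refine Prod.ext (Prod.ext ?_ ?_) ?_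
  · simpa using (hsq w).1
  · simp
  · simp

/-- Square-zero endomorphisms of `(F × F) × W` sending the first basis vector to the second. -/
def sqZeroExtendEquiv [FiniteDimensional F W] (r : ℕ) :
    {N : SqZero F ((F × F) × W) (r + 1) // N.1 ((1, 0), 0) = ((0, 1), 0)} ≃
      SqZero F W r × (W →ₗ[F] F) where
  toFun N := (⟨LinearMap.snd F (F × F) W ∘ₗ N.1.1 ∘ₗ LinearMap.inr F (F × F) W, by
      obtain ⟨⟨N, hN, hr⟩, h1⟩ := N
      obtain ⟨h, h'⟩ := eq_sqZeroExtend hN h1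
      refine ⟨h', ?_⟩
      rw [h, (kerSqZeroExtend _ _).finrank_eq] at hr
      simp only [finrank_prod, finrank_self] at hr
      simp only
      omega⟩,
    LinearMap.snd F F F ∘ₗ LinearMap.fst F (F × F) W ∘ₗ N.1.1 ∘ₗ LinearMap.inr F (F × F) W)
  invFun M := ⟨⟨sqZeroExtend M.1.1 M.2, sqZeroExtend_mul_self M.1.2.1 _, by
    have := M.1.2.2
    rw [(kerSqZeroExtend _ _).finrank_eq]
    simp only [finrank_prod, finrank_self]
    omega⟩, by simp⟩
  left_inv N := Subtype.ext (Subtype.ext (eq_sqZeroExtend N.1.2.1 N.2).1.symm)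
  right_inv M := by ext <;> simp

/-- Conjugation by a linear equivalence preserves square-zero endomorphisms of rank `r`. -/
def sqZeroConj (e : V ≃ₗ[F] W) (r : ℕ) : SqZero F V r ≃ SqZero F W r :=
  e.conj.toEquiv.subtypeEquiv fun N => by
    have hk : finrank F (LinearMap.ker (e.conj N)) = finrank F (LinearMap.ker N) := by
      have : LinearMap.ker (e.conj N) = (LinearMap.ker N).map (e : V →ₗ[F] W) := by
        ext w
        simp [LinearEquiv.conj_apply, Submodule.mem_map_equiv]
      rw [this, LinearEquiv.finrank_map_eq]
    have hm : e.conj N * e.conj N = 0 ↔ N * N = 0 := by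
      rw [Module.End.mul_eq_comp, ← LinearEquiv.conj_comp]
      simp [Module.End.mul_eq_comp]
    change _ ↔ e.conj N * e.conj N = 0 ∧ finrank F (LinearMap.ker (e.conj N)) + r = _
    rw [hm, hk, e.finrank_eq]

theorem exists_linearEquiv_of_linearIndependent [FiniteDimensional F V] {n : ℕ}
    (hn : finrank F V = n + 2) (s : Fin 2 → V) (hs : LinearIndependent F s) :
    ∃ e : V ≃ₗ[F] (F × F) × (Fin n → F), e (s 0) = ((1, 0), 0) ∧ e (s 1) = ((0, 1), 0) := by
  classical
  let b := Basis.sumExtend hs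
  have hfin : Finite (Fin 2 ⊕ Basis.sumExtendIndex hs) := Module.Finite.finite_basis b
  have : Finite (Basis.sumExtendIndex hs) := Finite.of_injective _ (Sum.inr_injective (α := Fin 2))
  have hc : Nat.card (Basis.sumExtendIndex hs) = n := by
    have := finrank_eq_nat_card_basis b
    rw [hn, Nat.card_sum, Nat.card_fin] at this
    omega
  let b' := b.reindex ((Equiv.refl (Fin 2)).sumCongr (Finite.equivFinOfCardEq hc))
  have hb : ∀ i, s i = b' (Sum.inl i) := fun i => by
    simp [b', b, Basis.sumExtend]
    rfl
  refine ⟨b'.equivFun ≪≫ₗ LinearEquiv.sumArrowLequivProdArrow _ _ F F ≪≫ₗ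
    (LinearEquiv.finTwoArrow F F).prodCongr (LinearEquiv.refl F _), ?_, ?_⟩
  all_goals
    rw [hb]
    simp
    ext i
    simp

theorem card_involutions_GL (h2 : (2 : F) = 0) (n : ℕ) :
    Nat.card {g : GL (Fin n) F // g ^ 2 = 1} =
      Nat.card {N : Module.End F (Fin n → F) // N * N = 0} := by
  have hadd (A : Matrix (Fin n) (Fin n) F) : A + A = 0 := by
    rw [← two_smul F A, h2, zero_smul]
  let e : {g : GL (Fin n) F // g ^ 2 = 1} ≃ {A : Matrix (Fin n) (Fin n) F // A * A = 0} :=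
    { toFun g := ⟨g.1.1 + 1, by
        have h : g.1.1 * g.1.1 = 1 := by
          rw [← sq]; exact congrArg Units.val g.2
        have : (g.1.1 + 1) * (g.1.1 + 1) = g.1.1 * g.1.1 + 1 + (g.1.1 + g.1.1) := by noncomm_ring
        rw [this, h, hadd, hadd, add_zero]⟩
      invFun A :=
        have h : (A.1 + 1) * (A.1 + 1) = 1 := by
          have : (A.1 + 1) * (A.1 + 1) = A.1 * A.1 + 1 + (A.1 + A.1) := by noncomm_ring
          rw [this, A.2, hadd, zero_add, add_zero]
        ⟨⟨A.1 + 1, A.1 + 1, h, h⟩, Units.ext (by rw [sq]; exact h)⟩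
      left_inv g := Subtype.ext (Units.ext (by simp [add_assoc, hadd]))
      right_inv A := Subtype.ext (by simp [add_assoc, hadd]) }
  refine Nat.card_congr (e.trans (Matrix.toLinAlgEquiv'.toEquiv.subtypeEquiv fun A => ?_))
  change _ ↔ Matrix.toLinAlgEquiv' A * Matrix.toLinAlgEquiv' A = 0
  rw [← map_mul, EmbeddingLike.map_eq_zero_iff]

theorem card_sqZero_zero (m : ℕ) : Nat.card (SqZero F (Fin m → F) 0) = 1 := by
  refine Nat.card_eq_one_iff_exists.2 ⟨⟨0, by simp, by rw [LinearMap.ker_zero, finrank_top, add_zero]⟩, fun N => Subtype.ext ?_⟩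
  have h := N.2.2
  rw [add_zero] at h
  exact LinearMap.ker_eq_top.1 (Submodule.eq_top_of_finrank_eq h)

theorem two_mul_le_of_sqZero {n r : ℕ} (N : SqZero F (Fin n → F) r) : 2 * r ≤ n := by
  have h1 := LinearMap.finrank_range_add_finrank_ker N.1
  have h2 := Submodule.finrank_mono (LinearMap.range_le_ker_iff.2 (show N.1 ∘ₗ N.1 = 0 from N.2.1))
  have h3 := N.2.2
  have h4 := finrank_fin_fun F (n := n)
  omega

variable [Fintype F]

theorem card_ker_compl [FiniteDimensional F V] (N : Module.End F V) :
    Nat.card {v // N v ≠ 0} =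
      Fintype.card F ^ finrank F V - Fintype.card F ^ finrank F (LinearMap.ker N) := by
  classical
  have : Finite V := Module.finite_of_finite F
  have h := Nat.card_congr (Equiv.sumCompl fun v => v ∈ LinearMap.ker N)
  rw [Nat.card_sum, Module.natCard_eq_pow_finrank (K := F) (V := V),
    Module.natCard_eq_pow_finrank (K := F) (V := LinearMap.ker N)] at h
  simp only [LinearMap.mem_ker] at h
  rw [← Nat.card_eq_fintype_card]
  exact Nat.eq_sub_of_add_eq' h

/-- A square-zero map together with a vector outside its kernel is the same as a linearly
independent pair together with a square-zero map sending the first vector to the second. -/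
def sigmaSqZeroEquiv (r : ℕ) :
    (Σ N : SqZero F V r, {v // N.1 v ≠ 0}) ≃
      Σ s : {s : Fin 2 → V // LinearIndependent F s}, {N : SqZero F V r // N.1 (s.1 0) = s.1 1} where
  toFun p := ⟨⟨![p.2.1, p.1.1 p.2.1], by
    obtain ⟨⟨N, hN, -⟩, v, hv⟩ := p
    rw [LinearIndependent.pair_iff]
    intro a b h
    have hNv : N (N v) = 0 := LinearMap.congr_fun hN v
    have ha : a = 0 := by simpa [hNv, hv] using congrArg N h
    exact ⟨ha, by simpa [ha, hv] using h⟩⟩, ⟨p.1, rfl⟩⟩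
  invFun p := ⟨p.2.1, p.1.1 0, by rw [p.2.2]; exact p.1.2.ne_zero 1⟩
  left_inv _ := rfl
  right_inv p := by
    obtain ⟨⟨s, hs⟩, N, h⟩ := p
    obtain ⟨v, w, rfl⟩ : ∃ v w, s = ![v, w] :=
      ⟨s 0, s 1, List.ofFn_injective (by simp)⟩
    change N.1 v = w at h
    subst h
    rfl

theorem card_sqZero_recursion (n r : ℕ) (hr : r ≤ n) :
    (Fintype.card F ^ (n + 2) - Fintype.card F ^ (n + 1 - r)) *
        Nat.card (SqZero F (Fin (n + 2) → F) (r + 1)) =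
      (Fintype.card F ^ (n + 2) - 1) * (Fintype.card F ^ (n + 2) - Fintype.card F) *
        (Fintype.card F ^ n * Nat.card (SqZero F (Fin n → F) r)) := by
  classical
  have hfin (k : ℕ) : Finite (Module.End F (Fin k → F)) := Module.finite_of_finite F
  have h := Nat.card_congr (sigmaSqZeroEquiv (F := F) (V := Fin (n + 2) → F) (r + 1))
  have := Fintype.ofFinite (SqZero F (Fin (n + 2) → F) (r + 1))
  have := Fintype.ofFinite {s : Fin 2 → (Fin (n + 2) → F) // LinearIndependent F s}
  rw [Nat.card_sigma, Nat.card_sigma] at h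
  have hl (N : SqZero F (Fin (n + 2) → F) (r + 1)) : Nat.card {v // N.1 v ≠ 0} =
      Fintype.card F ^ (n + 2) - Fintype.card F ^ (n + 1 - r) := by
    have := N.2.2
    have hd := finrank_fin_fun F (n := n + 2)
    rw [card_ker_compl]
    congr 2
    omega
  have hr (s : {s : Fin 2 → (Fin (n + 2) → F) // LinearIndependent F s}) :
      Nat.card {N : SqZero F (Fin (n + 2) → F) (r + 1) // N.1 (s.1 0) = s.1 1} =
        Fintype.card F ^ n * Nat.card (SqZero F (Fin n → F) r) := by
    obtain ⟨e, h0, h1⟩ := exists_linearEquiv_of_linearIndependent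
      (by rw [finrank_fin_fun]) s.1 s.2
    have hE := (sqZeroConj e (r + 1)).subtypeEquiv (p := fun N => N.1 (s.1 0) = s.1 1)
      (q := fun N => N.1 ((1, 0), 0) = ((0, 1), 0)) fun N => by
        change _ ↔ e.conj N.1 _ = _
        rw [LinearEquiv.conj_apply_apply, ← h0, ← h1, e.symm_apply_apply, e.injective.eq_iff]
    rw [Nat.card_congr (hE.trans (sqZeroExtendEquiv r)), Nat.card_prod, mul_comm,
      Module.natCard_eq_pow_finrank (K := F) (V := (Fin n → F) →ₗ[F] F), Nat.card_eq_fintype_card]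
    simp
  have hp : Nat.card {s : Fin 2 → (Fin (n + 2) → F) // LinearIndependent F s} =
      (Fintype.card F ^ (n + 2) - 1) * (Fintype.card F ^ (n + 2) - Fintype.card F) := by
    rw [card_linearIndependent (by simp)]
    simp [Fin.prod_univ_two]
  simp only [hl, hr, sum_const, card_univ, smul_eq_mul] at h
  rw [← Nat.card_eq_fintype_card, ← Nat.card_eq_fintype_card (α := {s : Fin 2 → _ // _}), hp] at h
  rw [mul_comm, h]

theorem card_sqZero (m r : ℕ) :
    (Nat.card (SqZero F (Fin (m + 2 * r) → F) r) : ℝ) =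
      (Fintype.card F : ℝ) ^ (2 * r * (m + r)) * (qPoch (Fintype.card F : ℝ)⁻¹ (m + 2 * r) /
        (qPoch (Fintype.card F : ℝ)⁻¹ r * qPoch (Fintype.card F : ℝ)⁻¹ m)) := by
  have hq1 : 1 < Fintype.card F := Fintype.one_lt_card
  have hq : (1 : ℝ) < Fintype.card F := by exact_mod_cast hq1
  have hp0 : (0 : ℝ) ≤ (Fintype.card F : ℝ)⁻¹ := by positivity
  have hp1 : (Fintype.card F : ℝ)⁻¹ < 1 := inv_lt_one_of_one_lt₀ hq
  have hpos := qPoch_pos hp0 hp1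
  induction r with
  | zero => simp [card_sqZero_zero, qPoch_zero, (hpos m).ne']
  | succ r ih =>
    have h := card_sqZero_recursion (F := F) (m + 2 * r) r (by omega)
    have h' := congrArg (Nat.cast (R := ℝ)) h
    have e1 := Nat.pow_le_pow_right hq1.le (show m + 2 * r + 1 - r ≤ m + 2 * r + 2 by omega)
    have e2 := Nat.one_le_pow (m + 2 * r + 2) _ hq1.le
    have e3 := Nat.le_self_pow (show m + 2 * r + 2 ≠ 0 by omega) (Fintype.card F)
    rw [Nat.cast_mul, Nat.cast_mul, Nat.cast_mul, Nat.cast_mul, Nat.cast_sub e1, Nat.cast_sub e2,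
      Nat.cast_sub e3, ih] at h'
    push_cast at h'
    set Q : ℝ := (Fintype.card F : ℝ)
    have hQ : Q ≠ 0 := by positivity
    have hr := (hpos r).ne'
    have hm := (hpos m).ne'
    have hf : 1 - Q⁻¹ ^ (r + 1) ≠ 0 := (sub_pos.2 (pow_lt_one₀ hp0 hp1 r.succ_ne_zero)).ne'
    have t1 : Q ^ (m + 2 * r + 2) - Q ^ (m + 2 * r + 1 - r) =
        Q ^ (m + 2 * r + 2) * (1 - Q⁻¹ ^ (r + 1)) := by
      have : Q ^ (m + 2 * r + 2) = Q ^ (m + 2 * r + 1 - r) * Q ^ (r + 1) := by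
        rw [← pow_add]; congr 1; omega
      rw [mul_sub, mul_one, inv_pow, this]
      field_simp
    have t2 : Q ^ (m + 2 * r + 2) - 1 = Q ^ (m + 2 * r + 2) * (1 - Q⁻¹ ^ (m + 2 * r + 2)) := by
      rw [inv_pow]; field_simp
    have t3 : Q ^ (m + 2 * r + 2) - Q =
        Q ^ (m + 2 * r + 2) * (1 - Q⁻¹ ^ (m + 2 * r + 1)) := by
      rw [inv_pow, pow_succ Q (m + 2 * r + 1)]; field_simp
    have t4 : Q ^ (2 * (r + 1) * (m + (r + 1))) =
        Q ^ (2 * r * (m + r)) * Q ^ (m + 2 * r + 2) * Q ^ (m + 2 * r) := by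
      rw [← pow_add, ← pow_add]; congr 1; ring
    rw [t1, t2, t3] at h'
    have hc : Q ^ (m + 2 * r + 2) * (1 - Q⁻¹ ^ (r + 1)) ≠ 0 := mul_ne_zero (by positivity) hf
    apply mul_left_cancel₀ hc
    rw [t4, show m + 2 * (r + 1) = m + 2 * r + 1 + 1 by ring, qPoch_succ _ (m + 2 * r + 1),
      qPoch_succ _ (m + 2 * r), qPoch_succ _ r]
    refine h'.trans ?_
    generalize 1 - Q⁻¹ ^ (r + 1) = a at hf ⊢
    field_simp

theorem card_mul_self_eq_zero (m : ℕ) :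
    Nat.card {N : Module.End F (Fin (2 * m) → F) // N * N = 0} =
      ∑ r ∈ range (m + 1), Nat.card (SqZero F (Fin (2 * m) → F) r) := by
  have : Finite (Module.End F (Fin (2 * m) → F)) := Module.finite_of_finite F
  let f (p : Σ r : Fin (m + 1), SqZero F (Fin (2 * m) → F) r) :
      {N : Module.End F (Fin (2 * m) → F) // N * N = 0} := ⟨p.2.1, p.2.2.1⟩
  have hf : Function.Bijective f := by
    constructor
    · rintro ⟨r, N, hN⟩ ⟨r', N', hN'⟩ h
      obtain rfl : N = N' := congrArg Subtype.val h
      obtain rfl : r = r' := Fin.ext (by have := hN.2; have := hN'.2; omega)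
      rfl
    · rintro ⟨N, hN⟩
      have h := LinearMap.finrank_range_add_finrank_ker N
      let N' : SqZero F (Fin (2 * m) → F) (finrank F (LinearMap.range N)) := ⟨N, hN, by omega⟩
      have := two_mul_le_of_sqZero N'
      exact ⟨⟨⟨finrank F (LinearMap.range N), by omega⟩, N'⟩, rfl⟩
  rw [← Nat.card_congr (Equiv.ofBijective f hf), Nat.card_sigma, Fin.sum_univ_eq_sum_range
    fun r => Nat.card (SqZero F (Fin (2 * m) → F) r)]

end SquareZero

theorem card_involutions_GL_div_eq {F : Type*} [Field F] [Fintype F] (h2 : (2 : F) = 0)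
    {x : ℝ} (hx : x ^ 2 = (Fintype.card F : ℝ)⁻¹) (m : ℕ) :
    (Nat.card {g : GL (Fin (2 * m)) F // g ^ 2 = 1} : ℝ) / (Fintype.card F : ℝ) ^ (2 * m ^ 2) =
      ∑ s ∈ range (m + 1), x ^ (4 * s ^ 2) *
        (qPoch (x ^ 2) (2 * m) / (qPoch (x ^ 2) (m - s) * qPoch (x ^ 2) (2 * s))) := by
  have hq : (Fintype.card F : ℝ) ≠ 0 := by exact_mod_cast Fintype.card_ne_zero
  rw [card_involutions_GL h2, card_mul_self_eq_zero, Nat.cast_sum, sum_div, ← sum_range_reflect]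
  refine sum_congr rfl fun s hs => ?_
  obtain ⟨r, rfl⟩ := Nat.exists_eq_add_of_le (Nat.lt_succ_iff.1 (mem_range.1 hs))
  have h := card_sqZero (F := F) (2 * s) r
  rw [← hx, show 2 * s + 2 * r = 2 * (s + r) by ring] at h
  rw [show s + r + 1 - 1 - s = r by omega, Nat.add_sub_cancel_left, h, mul_div_right_comm]
  congr 1
  rw [show 4 * s ^ 2 = 2 * (2 * s ^ 2) by ring, pow_mul x, hx, inv_pow, div_eq_iff (by positivity),
    ← div_eq_inv_mul, eq_div_iff (by positivity), ← pow_add]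
  congr 1
  ring

theorem tendsto_sum_qPoch {x : ℝ} (h0 : 0 ≤ x) (h1 : x < 1) :
    Tendsto (fun m : ℕ => ∑ s ∈ range (m + 1), x ^ (4 * s ^ 2) *
      (qPoch (x ^ 2) (2 * m) / (qPoch (x ^ 2) (m - s) * qPoch (x ^ 2) (2 * s)))) atTop
      (𝓝 (∑' s : ℕ, x ^ (4 * s ^ 2) / qPoch (x ^ 2) (2 * s))) := by
  have hQ0 : 0 ≤ x ^ 2 := by positivity
  have hQ1 : x ^ 2 < 1 := pow_lt_one₀ h0 h1 two_ne_zero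
  have hpos := qPoch_pos hQ0 hQ1
  set E := ∏' i : ℕ, (1 - (x ^ 2) ^ (i + 1)) with hE
  have hEpos : 0 < E := tprod_one_sub_pow_succ_pos hQ0 hQ1
  have hlim : ∀ w : ℕ → ℕ, Tendsto w atTop atTop →
      Tendsto (fun n => qPoch (x ^ 2) (w n)) atTop (𝓝 E) :=
    fun w hw => (tendsto_qPoch hQ0 hQ1).comp hw
  have hsum : Summable fun s : ℕ => x ^ (4 * s ^ 2) := by
    simpa only [pow_mul] using summable_pow_sq (pow_nonneg h0 4) (pow_lt_one₀ h0 h1 four_ne_zero)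
  have key : Tendsto (fun m : ℕ => ∑' s : ℕ, if s ≤ m then x ^ (4 * s ^ 2) *
      (qPoch (x ^ 2) (2 * m) / (qPoch (x ^ 2) (m - s) * qPoch (x ^ 2) (2 * s))) else 0) atTop
      (𝓝 (∑' s : ℕ, x ^ (4 * s ^ 2) / qPoch (x ^ 2) (2 * s))) := by
    refine tendsto_tsum_of_dominated_convergence (hsum.mul_right (1 / (E * E)))
      (fun s => ?_) (Eventually.of_forall fun m s => ?_)
    · have hs := (hpos (2 * s)).ne'
      have := ((hlim (fun m => 2 * m) (tendsto_atTop_mono (fun m => Nat.le_mul_of_pos_left m two_pos) tendsto_id)).div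
        ((hlim _ (tendsto_sub_atTop_nat s)).mul_const (qPoch (x ^ 2) (2 * s)))
        (mul_ne_zero hEpos.ne' hs)).const_mul (x ^ (4 * s ^ 2))
      rw [show x ^ (4 * s ^ 2) / qPoch (x ^ 2) (2 * s) =
        x ^ (4 * s ^ 2) * (E / (E * qPoch (x ^ 2) (2 * s))) by field_simp]
      refine this.congr' ?_
      filter_upwards [eventually_ge_atTop s] with m hm
      rw [if_pos hm]
      rfl
    · have hms := hpos (m - s)
      have hs := hpos (2 * s)
      have hm := hpos (2 * m)
      split_ifs
      · rw [Real.norm_of_nonneg (by positivity)]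
        gcongr
        · exact qPoch_le_one hQ0 hQ1 _
        · exact tprod_le_qPoch hQ0 hQ1 _
        · exact tprod_le_qPoch hQ0 hQ1 _
      · rw [norm_zero]
        positivity
  refine key.congr fun m => ?_
  rw [tsum_eq_sum (s := range (m + 1))]
  · exact sum_congr rfl fun s hs => if_pos (Nat.lt_succ_iff.1 (mem_range.1 hs))
  · exact fun s hs => if_neg (by simpa using hs)

/-- For fixed even prime power `q`, the limit over even `n` of `i_GL(n,q)/q^{n²/2}`, where
`i_GL(n,q)` is the number of solutions of `g² = 1` in `GL(n, F_q)`, equals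
`(1/2)[∏_{i≥1}(1+√q/qⁱ) + ∏_{i≥1}(1-√q/qⁱ)]`, and this value equals
`∏_{i≥1}(1+q^{5-8i})(1+q^{3-8i})(1-q^{-8i})/(1-q^{-2i})`. -/
theorem involutions_GL_even_char_limit (q : ℕ) (hq : ∃ k : ℕ, 0 < k ∧ q = 2 ^ k)
    (F : Type*) [Field F] [Fintype F] (hF : Fintype.card F = q) :
    Filter.Tendsto
      (fun m : ℕ => (Nat.card {g : GL (Fin (2 * m)) F // g ^ 2 = 1} : ℝ) / (q : ℝ) ^ (2 * m ^ 2))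
      Filter.atTop
      (nhds ((1 / 2) * ((∏' i : ℕ, (1 + Real.sqrt q / (q : ℝ) ^ (i + 1)))
        + ∏' i : ℕ, (1 - Real.sqrt q / (q : ℝ) ^ (i + 1))))) ∧
    (1 / 2) * ((∏' i : ℕ, (1 + Real.sqrt q / (q : ℝ) ^ (i + 1)))
        + ∏' i : ℕ, (1 - Real.sqrt q / (q : ℝ) ^ (i + 1))) =
      ∏' i : ℕ, ((1 + (q : ℝ) ^ ((5 : ℤ) - 8 * ((i : ℤ) + 1)))
        * (1 + (q : ℝ) ^ ((3 : ℤ) - 8 * ((i : ℤ) + 1)))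
        * (1 - (q : ℝ) ^ (-(8 : ℤ) * ((i : ℤ) + 1)))
        / (1 - (q : ℝ) ^ (-(2 : ℤ) * ((i : ℤ) + 1)))) := by
  have h2 : (2 : F) = 0 := by
    obtain ⟨k, -, hk⟩ := hq
    have h := FiniteField.cast_card_eq_zero F
    rw [hF, hk, Nat.cast_pow] at h
    exact_mod_cast eq_zero_of_pow_eq_zero h
  subst hF
  have hq1 : (1 : ℝ) < Fintype.card F := by exact_mod_cast Fintype.one_lt_card
  have hq0 : (0 : ℝ) < Fintype.card F := zero_lt_one.trans hq1
  set Q : ℝ := (Fintype.card F : ℝ)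
  set x : ℝ := (√Q)⁻¹ with hx
  have hsq : √Q ^ 2 = Q := Real.sq_sqrt hq0.le
  have hx0 : 0 < x := by positivity
  have hx1 : x < 1 := inv_lt_one_of_one_lt₀ (Real.lt_sqrt_of_sq_lt (by simpa using hq1))
  have hx2 : x ^ 2 = Q⁻¹ := by rw [hx, inv_pow, hsq]
  have hodd (i : ℕ) : √Q / Q ^ (i + 1) = x ^ (2 * i + 1) := by
    have hs : √Q ≠ 0 := by positivity
    rw [hx, inv_pow, div_eq_iff (by positivity), ← div_eq_inv_mul, eq_div_iff (by positivity)]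
    conv_rhs => rw [← hsq]
    ring
  have hz (n : ℕ) (e : ℤ) (he : e = -n) : Q ^ e = x ^ (2 * n) := by
    rw [he, zpow_neg, zpow_natCast, pow_mul, hx2, inv_pow]
  have hval : (1 / 2) * ((∏' i : ℕ, (1 + √Q / Q ^ (i + 1))) + ∏' i : ℕ, (1 - √Q / Q ^ (i + 1))) =
      1 / 2 * ((∏' i : ℕ, (1 + 1 * x ^ (2 * i + 1))) + ∏' i : ℕ, (1 + -1 * x ^ (2 * i + 1))) := by
    simp only [hodd, one_mul, neg_mul, ← sub_eq_add_neg]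
  rw [hval]
  constructor
  · rw [tprod_half_sum_eq_tsum hx0.le hx1]
    exact (tendsto_sum_qPoch hx0.le hx1).congr fun m => (card_involutions_GL_div_eq h2 hx2 m).symm
  · rw [tprod_half_sum_eq_tprod hx0 hx1]
    refine tprod_congr fun i => ?_
    rw [hz (8 * i + 3) _ (by push_cast; ring), hz (8 * i + 5) _ (by push_cast; ring),
      hz (8 * (i + 1)) _ (by push_cast; ring), hz (2 * (i + 1)) _ (by push_cast; ring)]
    ring_nf
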